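/- Let 0 < α < 1, q > 1, t > 0 and let K ≥ 1 be an integer. Then 0 ≤ E_α(−t^α) − ∑_{k=0}^{K} ∫_{c_k − r_k}^{c_k + r_k} f(x,t,α) dx ≤ 1/(q^K − 1). -/

import Mathlib

open scoped Real
open MeasureTheory

/-- The one-parameter Mittag-Leffler function (real version). -/
noncomputable def mittagLeffler (α x : ℝ) : ℝ :=
  ∑' j : ℕ, x ^ j / Real.Gamma ((j : ℝ) * α + 1)

/-- The kernel `f(x,t,α) = (sin(απ)/(απ)) · e^{−t x^{−1/α}} / (x² + 2x cos(απ) + 1)`. -/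
noncomputable def fKer (x t α : ℝ) : ℝ :=
  (Real.sin (α * π) / (α * π)) *
    Real.exp (-(t * x ^ (-(1 / α)))) / (x ^ 2 + 2 * x * Real.cos (α * π) + 1)

/-- The centers `c₀ = 1/2`, `c_k = (q+1) q^{k−1} / 2` for `k ≥ 1`. -/
noncomputable def cCtr (q : ℝ) : ℕ → ℝ
  | 0 => 1 / 2
  | k + 1 => (q + 1) * q ^ k / 2

/-- The radii `r₀ = 1/2`, `r_k = (q−1) q^{k−1} / 2` for `k ≥ 1`. -/
noncomputable def rRad (q : ℝ) : ℕ → ℝ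
  | 0 => 1 / 2
  | k + 1 => (q - 1) * q ^ k / 2

open Complex Filter Topology Set

/-- The jump of `g` across the strip `|Im w| ≤ π`. -/
noncomputable def stripJump (g : ℂ → ℂ) (u : ℝ) : ℂ := g (u + π * I) - g (u - π * I)

/-- The integral of `g` along the boundary of the half-strip `Re w ≥ ρ`, `|Im w| ≤ π`; under
`z = exp w` this is a Hankel contour. -/
noncomputable def hankelIntegral (g : ℂ → ℂ) (ρ : ℝ) : ℂ :=
  (∫ u in Ioi ρ, stripJump g u) + I * ∫ θ in (-π)..π, g (ρ + θ * I)

lemma continuous_horizontal_edge {g : ℂ → ℂ} (hd : ∀ w : ℂ, |w.im| ≤ π → DifferentiableAt ℂ g w)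
    {s : ℝ} (hs : |s| ≤ π) : Continuous fun u : ℝ => g (u + s * I) := by
  rw [continuous_iff_continuousAt]
  intro u
  have h := (hd (u + s * I) (by simpa using hs)).continuousAt
  exact ContinuousAt.comp (f := fun u : ℝ => (u + s * I : ℂ)) h (by fun_prop)

lemma continuousOn_vertical_edge {g : ℂ → ℂ} (hd : ∀ w : ℂ, |w.im| ≤ π → DifferentiableAt ℂ g w)
    (ρ : ℝ) : ContinuousOn (fun θ : ℝ => g (ρ + θ * I)) (uIcc (-π) π) := by
  intro θ hθ
  rw [uIcc_of_le (by linarith [Real.pi_pos])] at hθ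
  have h := (hd (ρ + θ * I) (by simpa using abs_le.2 hθ)).continuousAt
  exact (ContinuousAt.comp (f := fun θ : ℝ => (ρ + θ * I : ℂ)) h (by fun_prop)).continuousWithinAt

lemma hankelIntegral_eq {g : ℂ → ℂ} (hd : ∀ w : ℂ, |w.im| ≤ π → DifferentiableAt ℂ g w)
    (hint : Integrable (stripJump g)) {ρ₁ ρ₂ : ℝ} :
    hankelIntegral g ρ₁ = hankelIntegral g ρ₂ := by
  have hrect := Complex.integral_boundary_rect_eq_zero_of_differentiableOn g
    (ρ₁ + (-π : ℝ) * I) (ρ₂ + (π : ℝ) * I) (by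
      intro w hw
      refine (hd w ?_).differentiableWithinAt
      have h2 := (Complex.mem_reProdIm.1 hw).2
      rw [abs_le]
      simpa [uIcc_of_le (show -π ≤ π by linarith [Real.pi_pos])] using h2)
  have hpi : |π| ≤ π := (abs_of_pos Real.pi_pos).le
  have c1 := continuous_horizontal_edge hd hpi
  have c2 := continuous_horizontal_edge hd (s := -π) (by rwa [abs_neg])
  simp only [add_re, ofReal_re, mul_re, I_re, mul_zero, ofReal_im, I_im, mul_one, sub_self,
    add_zero, add_im, mul_im, zero_add, smul_eq_mul] at hrect
  have hj : ∫ u in ρ₁..ρ₂, stripJump g u =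
      (∫ u in ρ₁..ρ₂, g (u + π * I)) - ∫ u in ρ₁..ρ₂, g (u + (-π : ℝ) * I) := by
    rw [← intervalIntegral.integral_sub (c1.intervalIntegrable _ _) (c2.intervalIntegrable _ _)]
    simp [stripJump, sub_eq_add_neg]
  have hs := intervalIntegral.integral_interval_add_Ioi
    (hint.integrableOn (s := Ioi ρ₁)) (hint.integrableOn (s := Ioi ρ₂))
  unfold hankelIntegral
  rw [← hs, hj]
  linear_combination -hrect

lemma hankelIntegral_eq_integral_stripJump {g : ℂ → ℂ}
    (hd : ∀ w : ℂ, |w.im| ≤ π → DifferentiableAt ℂ g w)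
    (hint : Integrable (stripJump g)) {L : ℂ} {C : ℝ}
    (hb : ∀ᶠ ρ : ℝ in atBot, ∀ θ : ℝ, ‖g (ρ + θ * I)‖ ≤ C)
    (hl : ∀ θ : ℝ, Tendsto (fun ρ : ℝ => g (ρ + θ * I)) atBot (𝓝 L)) (ρ : ℝ) :
    hankelIntegral g ρ = (∫ u, stripJump g u) + 2 * π * I * L := by
  have h1 : Tendsto (fun ρ : ℝ => ∫ u in Ioi ρ, stripJump g u) atBot (𝓝 (∫ u, stripJump g u)) :=
    (aecover_Ioi tendsto_id).integral_tendsto_of_countably_generated hint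
  have h2 : Tendsto (fun ρ : ℝ => ∫ θ in (-π)..π, g (ρ + θ * I)) atBot
      (𝓝 (∫ _ in (-π)..π, L)) := by
    refine intervalIntegral.tendsto_integral_filter_of_dominated_convergence (fun _ => C)
      (Eventually.of_forall fun r => ?_) ?_ intervalIntegrable_const
      (Eventually.of_forall fun θ _ => hl θ)
    · exact ((continuousOn_vertical_edge hd r).mono uIoc_subset_uIcc).aestronglyMeasurable
        measurableSet_uIoc
    · filter_upwards [hb] with r hr
      exact Eventually.of_forall fun θ _ => hr θ
  have h3 := h1.add (h2.const_mul I)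
  have h4 : Tendsto (fun r : ℝ => hankelIntegral g r) atBot (𝓝 (hankelIntegral g ρ)) := by
    simp_rw [fun r => hankelIntegral_eq hd hint (ρ₁ := r) (ρ₂ := ρ)]
    exact tendsto_const_nhds
  rw [tendsto_nhds_unique h4 h3, intervalIntegral.integral_const]
  simp only [real_smul]
  push_cast
  ring

lemma image_exp_mul_univ {c : ℝ} (hc : c ≠ 0) :
    (fun u : ℝ => Real.exp (c * u)) '' univ = Ioi 0 := by
  ext x
  simp only [image_univ, mem_range, mem_Ioi]
  refine ⟨fun ⟨u, hu⟩ => hu ▸ Real.exp_pos _, fun hx => ⟨Real.log x / c, ?_⟩⟩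
  rw [mul_div_cancel₀ _ hc, Real.exp_log hx]

lemma hasDerivAt_exp_mul (c u : ℝ) :
    HasDerivAt (fun u : ℝ => Real.exp (c * u)) (c * Real.exp (c * u)) u := by
  simpa [mul_comm] using ((hasDerivAt_id u).const_mul c).exp

lemma injective_exp_mul {c : ℝ} (hc : c ≠ 0) :
    Function.Injective fun u : ℝ => Real.exp (c * u) :=
  Real.exp_injective.comp (mul_right_injective₀ hc)

lemma integral_Ioi_eq_integral_comp_exp_mul {c : ℝ} (hc : c ≠ 0) (f : ℝ → ℝ) :
    ∫ x in Ioi 0, f x = ∫ u, |c| * Real.exp (c * u) * f (Real.exp (c * u)) := by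
  rw [← image_exp_mul_univ hc, integral_image_eq_integral_abs_deriv_smul MeasurableSet.univ
    (fun u _ => (hasDerivAt_exp_mul c u).hasDerivWithinAt) (injective_exp_mul hc).injOn]
  simp [abs_mul]

lemma integrable_comp_exp_mul {c : ℝ} (hc : c ≠ 0) {f : ℝ → ℝ} (hf : IntegrableOn f (Ioi 0)) :
    Integrable fun u => |c| * Real.exp (c * u) * f (Real.exp (c * u)) := by
  rw [← image_exp_mul_univ hc, integrableOn_image_iff_integrableOn_abs_deriv_smul
    MeasurableSet.univ (fun u _ => (hasDerivAt_exp_mul c u).hasDerivWithinAt)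
    (injective_exp_mul hc).injOn] at hf
  simpa [abs_mul] using hf

lemma integrable_exp_mul_exp_neg_exp {a t : ℝ} (ha : a < 0) (ht : 0 < t) :
    Integrable fun u : ℝ => Real.exp (-(a * u)) * Real.exp (-(t * Real.exp u)) := by
  have h := integrable_comp_exp_mul one_ne_zero
    (integrableOn_rpow_mul_exp_neg_mul_rpow (p := 1) (s := -a - 1) (b := t)
      (by linarith) one_pos ht)
  refine h.congr (Eventually.of_forall fun u => ?_)
  simp only [abs_one, one_mul, Real.rpow_one, neg_mul]
  rw [← Real.exp_mul, ← mul_assoc, ← Real.exp_add]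
  ring_nf

lemma integral_exp_mul_exp_neg_exp {a t : ℝ} (ha : a < 0) (ht : 0 < t) :
    ∫ u : ℝ, Real.exp (-(a * u)) * Real.exp (-(t * Real.exp u)) = t ^ a * Real.Gamma (-a) := by
  have h := Real.integral_rpow_mul_exp_neg_mul_Ioi (neg_pos.2 ha) ht
  rw [integral_Ioi_eq_integral_comp_exp_mul one_ne_zero] at h
  rw [one_div, Real.inv_rpow ht.le, Real.rpow_neg ht.le, inv_inv] at h
  rw [← h]
  congr 1 with u
  simp only [abs_one, one_mul, ← Real.exp_mul, ← Real.exp_add]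
  ring_nf

lemma tendsto_exp_mul_exp_neg_exp (a : ℝ) {t : ℝ} (ht : 0 < t) :
    Tendsto (fun u : ℝ => Real.exp (-(a * u)) * Real.exp (-(t * Real.exp u))) atTop (𝓝 0) := by
  refine ((tendsto_rpow_mul_exp_neg_mul_atTop_nhds_zero (-a) t ht).comp
    Real.tendsto_exp_atTop).congr fun u => ?_
  simp only [Function.comp]
  rw [← Real.exp_mul]
  ring_nf

lemma integrableOn_exp_mul_exp_neg_exp (a ρ : ℝ) {t : ℝ} (ht : 0 < t) :
    IntegrableOn (fun u : ℝ => Real.exp (-(a * u)) * Real.exp (-(t * Real.exp u))) (Ioi ρ) := by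
  refine integrable_of_isBigO_exp_neg one_pos (by fun_prop) ?_
  refine Asymptotics.IsLittleO.isBigO ((Asymptotics.isLittleO_iff_tendsto'
    (Eventually.of_forall fun u h => absurd h (Real.exp_pos _).ne')).2
      ((tendsto_exp_mul_exp_neg_exp (a - 1) ht).congr fun u => ?_))
  rw [eq_div_iff (Real.exp_pos _).ne', ← Real.exp_add, ← Real.exp_add, ← Real.exp_add]
  ring_nf

/-- In the variable `w = log z`, the integrand `z ^ (-a) * exp (t z)` of Hankel's formula. -/
noncomputable def hankelPow (a t : ℝ) (w : ℂ) : ℂ := cexp (-(a * w)) * cexp (t * cexp w)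

lemma cexp_mul_cexp_add_pi (t u : ℝ) :
    cexp (t * cexp (u + π * I)) = (Real.exp (-(t * Real.exp u)) : ℝ) := by
  rw [Complex.exp_add, exp_pi_mul_I]
  push_cast
  ring_nf

lemma cexp_mul_cexp_sub_pi (t u : ℝ) :
    cexp (t * cexp (u - π * I)) = (Real.exp (-(t * Real.exp u)) : ℝ) := by
  rw [sub_eq_add_neg, Complex.exp_add, Complex.exp_neg, exp_pi_mul_I]
  push_cast
  ring_nf

lemma hankelPow_add_pi (a t u : ℝ) : hankelPow a t (u + π * I) =
    cexp (-(a * π * I)) * (Real.exp (-(a * u)) * Real.exp (-(t * Real.exp u)) : ℝ) := by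
  rw [hankelPow, cexp_mul_cexp_add_pi, ofReal_mul, ← mul_assoc]
  congr 1
  push_cast
  rw [← Complex.exp_add]
  ring_nf

lemma hankelPow_sub_pi (a t u : ℝ) : hankelPow a t (u - π * I) =
    cexp (a * π * I) * (Real.exp (-(a * u)) * Real.exp (-(t * Real.exp u)) : ℝ) := by
  rw [hankelPow, cexp_mul_cexp_sub_pi, ofReal_mul, ← mul_assoc]
  congr 1
  push_cast
  rw [← Complex.exp_add]
  ring_nf

lemma stripJump_hankelPow (a t u : ℝ) : stripJump (hankelPow a t) u =
    -(2 * I * Real.sin (a * π)) *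
      (Real.exp (-(a * u)) * Real.exp (-(t * Real.exp u)) : ℝ) := by
  rw [stripJump, hankelPow_add_pi, hankelPow_sub_pi, ← sub_mul]
  congr 1
  rw [ofReal_sin, Complex.sin]
  push_cast
  rw [show -(a * π * I : ℂ) = -(a * π) * I by ring]
  linear_combination (cexp (-(a * π) * I) - cexp (a * π * I)) * I_sq

lemma differentiable_hankelPow (a t : ℝ) : Differentiable ℂ (hankelPow a t) := by
  unfold hankelPow
  fun_prop

lemma norm_cexp_mul_cexp_le {t : ℝ} (ht : 0 < t) (w : ℂ) :
    ‖cexp (t * cexp w)‖ ≤ Real.exp (t * Real.exp w.re) := by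
  refine (norm_exp_le_exp_norm _).trans (Real.exp_le_exp.2 ?_)
  rw [norm_mul, Complex.norm_exp, Complex.norm_real, Real.norm_of_nonneg ht.le]

lemma norm_cexp_neg_mul (a : ℝ) (w : ℂ) : ‖cexp (-(a * w))‖ = Real.exp (-(a * w.re)) := by
  simp [Complex.norm_exp]

lemma tendsto_cexp_mul_cexp_atBot (t θ : ℝ) :
    Tendsto (fun ρ : ℝ => cexp (t * cexp (ρ + θ * I))) atBot (𝓝 1) := by
  have h : Tendsto (fun ρ : ℝ => cexp (ρ + θ * I)) atBot (𝓝 0) := by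
    rw [tendsto_zero_iff_norm_tendsto_zero]
    simpa [Complex.norm_exp] using Real.tendsto_exp_atBot
  have h2 := (h.const_mul (t : ℂ)).cexp
  simpa using h2

lemma stripJump_hankelPow_integrable {a t : ℝ} (ha : a ≤ 0) (ht : 0 < t) :
    Integrable (stripJump (hankelPow a t)) := by
  simp_rw [funext (stripJump_hankelPow a t)]
  rcases ha.eq_or_lt with rfl | ha
  · simp
  · exact ((integrable_exp_mul_exp_neg_exp ha ht).ofReal).const_mul _

lemma inv_Gamma_add_one {a : ℝ} (ha : a < 0) :
    (Real.Gamma (a + 1))⁻¹ = -(Real.sin (a * π) * Real.Gamma (-a) / π) := by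
  have h := Real.Gamma_mul_Gamma_one_sub (-a)
  rw [show 1 - -a = a + 1 by ring, show π * -a = -(a * π) by ring, Real.sin_neg] at h
  have hG : Real.Gamma (-a) ≠ 0 := (Real.Gamma_pos_of_pos (by linarith)).ne'
  by_cases hs : Real.sin (a * π) = 0
  · have : Real.Gamma (a + 1) = 0 := by simpa [hs, hG] using h
    simp [this, hs]
  · have h2 : Real.Gamma (a + 1) = π / -Real.sin (a * π) / Real.Gamma (-a) := by
      rw [← h]; field_simp
    rw [h2]
    field_simp

lemma hankelIntegral_hankelPow_of_nonpos {a t : ℝ} (ha : a ≤ 0) (ht : 0 < t) (ρ : ℝ) :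
    hankelIntegral (hankelPow a t) ρ = 2 * π * I * (t ^ a / Real.Gamma (a + 1) : ℝ) := by
  have hd : ∀ w : ℂ, |w.im| ≤ π → DifferentiableAt ℂ (hankelPow a t) w :=
    fun w _ => differentiable_hankelPow a t w
  have hb : ∀ᶠ ρ : ℝ in atBot, ∀ θ : ℝ, ‖hankelPow a t (ρ + θ * I)‖ ≤ Real.exp t := by
    filter_upwards [eventually_le_atBot 0] with r hr θ
    rw [hankelPow, norm_mul, norm_cexp_neg_mul]
    have h1 := norm_cexp_mul_cexp_le ht (r + θ * I)
    simp only [add_re, ofReal_re, mul_re, I_re, mul_zero, ofReal_im, I_im, mul_one, sub_self,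
      add_zero] at h1 ⊢
    have h2 : Real.exp (-(a * r)) ≤ 1 := Real.exp_le_one_iff.2 (by nlinarith)
    have h3 : Real.exp (t * Real.exp r) ≤ Real.exp t :=
      Real.exp_le_exp.2 (mul_le_of_le_one_right ht.le (Real.exp_le_one_iff.2 hr))
    calc _ ≤ 1 * Real.exp t := by gcongr; exact h1.trans h3
      _ = _ := one_mul _
  rcases ha.eq_or_lt with rfl | ha'
  · rw [hankelIntegral_eq_integral_stripJump hd (stripJump_hankelPow_integrable ha ht) (L := 1) hb]
    · simp [stripJump_hankelPow]
    · intro θ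
      simpa [hankelPow] using tendsto_cexp_mul_cexp_atBot t θ
  · rw [hankelIntegral_eq_integral_stripJump hd (stripJump_hankelPow_integrable ha ht) (L := 0) hb]
    · simp_rw [stripJump_hankelPow]
      rw [integral_const_mul, integral_complex_ofReal, integral_exp_mul_exp_neg_exp ha' ht, div_eq_mul_inv,
        inv_Gamma_add_one ha']
      have hpi : (π : ℂ) ≠ 0 := ofReal_ne_zero.2 Real.pi_ne_zero
      push_cast
      field_simp
      ring
    · intro θ
      have h : Tendsto (fun ρ : ℝ => cexp (-(a * (ρ + θ * I)))) atBot (𝓝 0) := by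
        rw [tendsto_zero_iff_norm_tendsto_zero]
        simp_rw [norm_cexp_neg_mul]
        refine Real.tendsto_exp_atBot.comp ?_
        simpa using tendsto_id.const_mul_atBot (neg_pos.2 ha')
      simpa [hankelPow] using h.mul (tendsto_cexp_mul_cexp_atBot t θ)

lemma integrableOn_hankelPow_add_pi (a ρ : ℝ) {t : ℝ} (ht : 0 < t) :
    IntegrableOn (fun u : ℝ => hankelPow a t (u + π * I)) (Ioi ρ) := by
  simp_rw [hankelPow_add_pi]
  exact ((integrableOn_exp_mul_exp_neg_exp a ρ ht).ofReal).const_mul _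

lemma integrableOn_hankelPow_sub_pi (a ρ : ℝ) {t : ℝ} (ht : 0 < t) :
    IntegrableOn (fun u : ℝ => hankelPow a t (u - π * I)) (Ioi ρ) := by
  simp_rw [hankelPow_sub_pi]
  exact ((integrableOn_exp_mul_exp_neg_exp a ρ ht).ofReal).const_mul _

lemma integrableOn_stripJump_hankelPow (a ρ : ℝ) {t : ℝ} (ht : 0 < t) :
    IntegrableOn (stripJump (hankelPow a t)) (Ioi ρ) :=
  (integrableOn_hankelPow_add_pi a ρ ht).sub (integrableOn_hankelPow_sub_pi a ρ ht)

lemma hasDerivAt_hankelPow (a t : ℝ) (w : ℂ) :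
    HasDerivAt (hankelPow a t) (t * hankelPow (a - 1) t w - a * hankelPow a t w) w := by
  have h1 : HasDerivAt (fun w : ℂ => cexp (-(a * w))) (cexp (-(a * w)) * -(a * 1)) w :=
    ((hasDerivAt_id w).const_mul (a : ℂ)).neg.cexp
  have h2 : HasDerivAt (fun w : ℂ => cexp (t * cexp w)) (cexp (t * cexp w) * (t * cexp w)) w :=
    ((Complex.hasDerivAt_exp w).const_mul (t : ℂ)).cexp
  refine (h1.mul h2).congr_deriv ?_
  have h3 : cexp (-(((a - 1 : ℝ) : ℂ) * w)) = cexp (-(a * w)) * cexp w := by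
    rw [← Complex.exp_add]; push_cast; ring_nf
  rw [hankelPow, hankelPow, h3]
  ring

lemma hankelIntegral_hankelPow_sub_one (a ρ : ℝ) {t : ℝ} (ht : 0 < t) :
    t * hankelIntegral (hankelPow (a - 1) t) ρ = a * hankelIntegral (hankelPow a t) ρ := by
  have hray : ∫ u in Ioi ρ, (t * stripJump (hankelPow (a - 1) t) u
      - a * stripJump (hankelPow a t) u) = 0 - stripJump (hankelPow a t) ρ := by
    refine integral_Ioi_of_hasDerivAt_of_tendsto' (f := stripJump (hankelPow a t))
      (fun u _ => ?_) ?_ ?_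
    · have hp := (hasDerivAt_hankelPow a t (u + π * I)).comp_add_const (u : ℂ) (π * I)
      have hm := (hasDerivAt_hankelPow a t (u - π * I)).comp_sub_const (u : ℂ) (π * I)
      refine (hp.comp_ofReal.sub hm.comp_ofReal).congr_deriv ?_
      simp only [stripJump]
      ring
    · exact ((integrableOn_stripJump_hankelPow _ ρ ht).const_mul _).sub
        ((integrableOn_stripJump_hankelPow _ ρ ht).const_mul _)
    · simp_rw [funext (stripJump_hankelPow a t)]
      simpa using ((continuous_ofReal.tendsto 0).comp
        (tendsto_exp_mul_exp_neg_exp a ht)).const_mul (-(2 * I * Real.sin (a * π)))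
  have hcont : ∀ b : ℝ, Continuous fun θ : ℝ => hankelPow b t (ρ + θ * I) := fun b =>
    (differentiable_hankelPow b t).continuous.comp (by fun_prop)
  have hvert : ∫ θ in (-π)..π, I * (t * hankelPow (a - 1) t (ρ + θ * I)
      - a * hankelPow a t (ρ + θ * I)) = stripJump (hankelPow a t) ρ := by
    have hder : ∀ θ ∈ uIcc (-π) π, HasDerivAt (fun θ : ℝ => hankelPow a t (ρ + θ * I))
        (I * (t * hankelPow (a - 1) t (ρ + θ * I) - a * hankelPow a t (ρ + θ * I))) θ := by
      intro θ _
      have hl : HasDerivAt (fun θ : ℂ => (ρ : ℂ) + θ * I) I (θ : ℂ) := by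
        simpa using ((hasDerivAt_id (θ : ℂ)).mul_const I).const_add (ρ : ℂ)
      refine (((hasDerivAt_hankelPow a t (ρ + θ * I)).comp (θ : ℂ) hl).comp_ofReal).congr_deriv ?_
      ring
    rw [intervalIntegral.integral_eq_sub_of_hasDerivAt hder
      ((continuous_const.mul ((continuous_const.mul (hcont _)).sub
        (continuous_const.mul (hcont _)))).intervalIntegrable _ _)]
    simp [stripJump, sub_eq_add_neg]
  rw [integral_sub ((integrableOn_stripJump_hankelPow _ ρ ht).const_mul _)
        ((integrableOn_stripJump_hankelPow _ ρ ht).const_mul _), integral_const_mul,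
        integral_const_mul] at hray
  rw [intervalIntegral.integral_const_mul, intervalIntegral.integral_sub
    (((hcont _).intervalIntegrable _ _).const_mul _)
    (((hcont _).intervalIntegrable _ _).const_mul _), intervalIntegral.integral_const_mul,
    intervalIntegral.integral_const_mul] at hvert
  unfold hankelIntegral
  linear_combination hray + hvert

/-- Hankel's formula for the reciprocal Gamma function. -/
lemma hankelIntegral_hankelPow (a ρ : ℝ) {t : ℝ} (ht : 0 < t) :
    hankelIntegral (hankelPow a t) ρ = 2 * π * I * (t ^ a / Real.Gamma (a + 1) : ℝ) := by
  have main : ∀ n : ℕ, ∀ a : ℝ, a ≤ n →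
      hankelIntegral (hankelPow a t) ρ = 2 * π * I * (t ^ a / Real.Gamma (a + 1) : ℝ) := by
    intro n
    induction n with
    | zero => exact fun a ha => hankelIntegral_hankelPow_of_nonpos (by simpa using ha) ht ρ
    | succ n ih =>
      intro a ha
      rcases le_or_gt a 0 with h0 | h0
      · exact hankelIntegral_hankelPow_of_nonpos h0 ht ρ
      have h := hankelIntegral_hankelPow_sub_one a ρ ht
      rw [ih (a - 1) (by push_cast at ha; linarith), sub_add_cancel] at h
      have hac : (a : ℂ) ≠ 0 := ofReal_ne_zero.2 h0.ne'
      have htc : (t : ℂ) ≠ 0 := ofReal_ne_zero.2 ht.ne'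
      have hG : (Real.Gamma a : ℂ) ≠ 0 := ofReal_ne_zero.2 (Real.Gamma_pos_of_pos h0).ne'
      apply mul_left_cancel₀ hac
      rw [← h, Real.Gamma_add_one h0.ne', Real.rpow_sub_one ht.ne']
      push_cast
      field_simp
  obtain ⟨n, hn⟩ := exists_nat_ge a
  exact main n a hn

lemma one_sub_abs_cos_pos {α : ℝ} (hα0 : 0 < α) (hα1 : α < 1) : 0 < 1 - |Real.cos (α * π)| := by
  have hs : 0 < Real.sin (α * π) :=
    Real.sin_pos_of_pos_of_lt_pi (by positivity) (by nlinarith [Real.pi_pos])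
  have h := Real.sin_sq_add_cos_sq (α * π)
  have : |Real.cos (α * π)| < 1 := by
    rw [← sq_lt_one_iff_abs_lt_one]
    nlinarith
  linarith

lemma one_sub_abs_mul_le (x c : ℝ) : (1 - |c|) * (1 + x ^ 2) ≤ x ^ 2 + 2 * x * c + 1 := by
  rcases abs_cases c with ⟨h, h0⟩ | ⟨h, h0⟩ <;> rw [h]
  · nlinarith [mul_nonneg h0 (sq_nonneg (x + 1))]
  · nlinarith [mul_nonneg (neg_pos.2 h0).le (sq_nonneg (x - 1))]

lemma fKer_denom_pos {α : ℝ} (hα0 : 0 < α) (hα1 : α < 1) (x : ℝ) :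
    0 < x ^ 2 + 2 * x * Real.cos (α * π) + 1 :=
  (mul_pos (one_sub_abs_cos_pos hα0 hα1) (by positivity)).trans_le (one_sub_abs_mul_le x _)

lemma sin_div_nonneg {α : ℝ} (hα0 : 0 < α) (hα1 : α < 1) : 0 ≤ Real.sin (α * π) / (α * π) :=
  div_nonneg (Real.sin_nonneg_of_nonneg_of_le_pi (by positivity) (by nlinarith [Real.pi_pos]))
    (by positivity)

lemma fKer_nonneg {α : ℝ} (hα0 : 0 < α) (hα1 : α < 1) (x t : ℝ) : 0 ≤ fKer x t α :=
  div_nonneg (mul_nonneg (sin_div_nonneg hα0 hα1) (Real.exp_pos _).le)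
    (fKer_denom_pos hα0 hα1 x).le

lemma fKer_le {α x t : ℝ} (hα0 : 0 < α) (hα1 : α < 1) (ht : 0 < t) (hx : 0 < x) :
    fKer x t α ≤ 1 / (x ^ 2 + 2 * x * Real.cos (α * π) + 1) := by
  refine div_le_div_of_nonneg_right ?_ (fKer_denom_pos hα0 hα1 x).le
  refine mul_le_one₀ (div_le_one_of_le₀ (Real.sin_le (by positivity)) (by positivity))
    (Real.exp_pos _).le (Real.exp_le_one_iff.2 (by simp only [neg_nonpos]; positivity))

lemma integrableOn_fKer {α t : ℝ} (hα0 : 0 < α) (hα1 : α < 1) (ht : 0 < t) :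
    IntegrableOn (fun x => fKer x t α) (Ioi 0) := by
  have hm : Measurable fun x => fKer x t α := by
    unfold fKer
    fun_prop
  refine Integrable.mono'
    ((integrable_inv_one_add_sq.const_mul (1 - |Real.cos (α * π)|)⁻¹).integrableOn)
    hm.aestronglyMeasurable ?_
  filter_upwards [ae_restrict_mem measurableSet_Ioi] with x hx
  rw [Real.norm_of_nonneg (fKer_nonneg hα0 hα1 x t), ← mul_inv, ← one_div]
  exact (fKer_le hα0 hα1 ht hx).trans (one_div_le_one_div_of_le
    (mul_pos (one_sub_abs_cos_pos hα0 hα1) (by positivity)) (one_sub_abs_mul_le x _))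

/-- In the variable `w = log z`, the integrand `z ^ α / (1 + z ^ α) * exp (t z)` of the contour
integral representing the Mittag-Leffler function. -/
noncomputable def hankelResolvent (α t : ℝ) (w : ℂ) : ℂ :=
  (1 + cexp (-(α * w)))⁻¹ * cexp (t * cexp w)

lemma one_add_cexp_ne_zero {α : ℝ} (hα0 : 0 < α) (hα1 : α < 1) {w : ℂ} (hw : |w.im| ≤ π) :
    1 + cexp (-(α * w)) ≠ 0 := by
  intro h
  have h1 : cexp (-(α * w)) = cexp (π * I) := by
    rw [exp_pi_mul_I]; linear_combination h
  obtain ⟨n, hn⟩ := Complex.exp_eq_exp_iff_exists_int.1 h1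
  have h2 := congrArg Complex.im hn
  simp at h2
  have h3 : |α * w.im| < π := by
    rw [abs_mul, abs_of_pos hα0]
    nlinarith [Real.pi_pos]
  have h4 : |α * w.im| = |1 + 2 * (n : ℝ)| * π := by
    rw [← abs_neg, h2, ← abs_of_pos Real.pi_pos, ← abs_mul, abs_of_pos Real.pi_pos]
    ring_nf
  have h5 : (1 : ℝ) ≤ |1 + 2 * (n : ℝ)| := by
    have : (1 : ℤ) ≤ |1 + 2 * n| := Int.one_le_abs (by omega)
    exact_mod_cast this
  nlinarith [Real.pi_pos]

lemma differentiableAt_hankelResolvent {α : ℝ} (t : ℝ) (hα0 : 0 < α) (hα1 : α < 1) {w : ℂ}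
    (hw : |w.im| ≤ π) : DifferentiableAt ℂ (hankelResolvent α t) w := by
  have h := one_add_cexp_ne_zero hα0 hα1 hw
  unfold hankelResolvent
  exact DifferentiableAt.mul (DifferentiableAt.inv (by fun_prop) h) (by fun_prop)

lemma stripJump_hankelResolvent {α : ℝ} (t : ℝ) (hα0 : 0 < α) (hα1 : α < 1) (u : ℝ) :
    stripJump (hankelResolvent α t) u = 2 * π * I *
      (|-α| * Real.exp (-α * u) * fKer (Real.exp (-α * u)) t α : ℝ) := by
  have hx : Real.exp (-α * u) ^ (-(1 / α)) = Real.exp u := by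
    rw [← Real.exp_mul]
    congr 1
    field_simp
  have hp : cexp (-(α * (u + π * I))) = Real.exp (-α * u) *
      (Real.cos (α * π) - Real.sin (α * π) * I) := by
    rw [show -(α * (u + π * I) : ℂ) = ((-α * u : ℝ) : ℂ) + ((-(α * π) : ℝ) : ℂ) * I by
      push_cast; ring, Complex.exp_add, exp_mul_I, ← ofReal_cos, ← ofReal_sin, Real.cos_neg,
      Real.sin_neg, ofReal_exp]
    push_cast
    ring
  have hm : cexp (-(α * (u - π * I))) = Real.exp (-α * u) *
      (Real.cos (α * π) + Real.sin (α * π) * I) := by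
    rw [show -(α * (u - π * I) : ℂ) = ((-α * u : ℝ) : ℂ) + ((α * π : ℝ) : ℂ) * I by
      push_cast; ring, Complex.exp_add, exp_mul_I, ← ofReal_cos, ← ofReal_sin, ofReal_exp]
  rw [stripJump, hankelResolvent, hankelResolvent, cexp_mul_cexp_add_pi, cexp_mul_cexp_sub_pi,
    hp, hm, fKer, hx, abs_neg, abs_of_pos hα0]
  have hden := (fKer_denom_pos hα0 hα1 (Real.exp (-α * u))).ne'
  have hcs : (Real.sin (α * π) : ℂ) ^ 2 + (Real.cos (α * π) : ℂ) ^ 2 = 1 := by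
    exact_mod_cast Real.sin_sq_add_cos_sq (α * π)
  generalize Real.exp (-α * u) = x at *
  generalize Real.exp (-(t * Real.exp u)) = e at *
  generalize Real.sin (α * π) = s at *
  generalize Real.cos (α * π) = c at *
  have hden' : (x ^ 2 + 2 * x * c + 1 : ℂ) ≠ 0 := by exact_mod_cast hden
  have hprod : (1 + x * (c - s * I) : ℂ) * (1 + x * (c + s * I)) = x ^ 2 + 2 * x * c + 1 := by
    linear_combination (x : ℂ) ^ 2 * hcs - (x : ℂ) ^ 2 * s ^ 2 * I_sq
  have h1 : (1 + x * (c - s * I) : ℂ) ≠ 0 := fun h => hden' (by rw [← hprod, h, zero_mul])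
  have h2 : (1 + x * (c + s * I) : ℂ) ≠ 0 := fun h => hden' (by rw [← hprod, h, mul_zero])
  have hα : (α : ℂ) ≠ 0 := ofReal_ne_zero.2 hα0.ne'
  have hπ : (π : ℂ) ≠ 0 := ofReal_ne_zero.2 Real.pi_ne_zero
  rw [← sub_mul, inv_sub_inv h1 h2, hprod]
  push_cast
  field_simp
  ring

lemma hankelIntegral_hankelResolvent {α t : ℝ} (hα0 : 0 < α) (hα1 : α < 1) (ht : 0 < t) (ρ : ℝ) :
    hankelIntegral (hankelResolvent α t) ρ =
      2 * π * I * (∫ x in Ioi 0, fKer x t α : ℝ) := by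
  have hα : -α ≠ 0 := neg_ne_zero.2 hα0.ne'
  rw [hankelIntegral_eq_integral_stripJump (L := 0) (C := Real.exp t)
    (fun w hw => differentiableAt_hankelResolvent t hα0 hα1 hw)]
  · simp_rw [stripJump_hankelResolvent t hα0 hα1]
    rw [integral_const_mul, integral_complex_ofReal,
      ← integral_Ioi_eq_integral_comp_exp_mul hα (fun x => fKer x t α)]
    simp
  · simp_rw [funext (stripJump_hankelResolvent t hα0 hα1)]
    exact ((integrable_comp_exp_mul hα (integrableOn_fKer hα0 hα1 ht)).ofReal).const_mul _
  · have h2 : Tendsto (fun r : ℝ => Real.exp (-(α * r))) atBot atTop := by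
      refine Real.tendsto_exp_atTop.comp ?_
      simpa using tendsto_id.const_mul_atBot_of_neg (neg_neg_of_pos hα0)
    filter_upwards [eventually_le_atBot 0, h2.eventually_ge_atTop 2] with r hr hr2 θ
    rw [hankelResolvent, norm_mul, norm_inv]
    have h1 := norm_cexp_mul_cexp_le ht (r + θ * I)
    have h4 := norm_cexp_neg_mul α (r + θ * I)
    simp only [add_re, ofReal_re, mul_re, I_re, mul_zero, ofReal_im, I_im, mul_one, sub_self,
      add_zero] at h1 h4
    have h3 : Real.exp (t * Real.exp r) ≤ Real.exp t :=
      Real.exp_le_exp.2 (mul_le_of_le_one_right ht.le (Real.exp_le_one_iff.2 hr))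
    have h5 : 1 ≤ ‖1 + cexp (-(α * (r + θ * I)))‖ := by
      have := norm_sub_le_norm_add (cexp (-(α * (r + θ * I)))) 1
      rw [add_comm _ (1 : ℂ), h4, norm_one] at this
      linarith
    calc _ ≤ 1 * Real.exp t :=
          mul_le_mul (inv_le_one_of_one_le₀ h5) (h1.trans h3) (norm_nonneg _) zero_le_one
      _ = _ := one_mul _
  · intro θ
    have h : Tendsto (fun r : ℝ => (1 + cexp (-(α * (r + θ * I))))⁻¹) atBot (𝓝 0) := by
      refine tendsto_inv₀_cobounded.comp ?_
      refine tendsto_const_add_cobounded _ |>.comp ?_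
      rw [← tendsto_norm_atTop_iff_cobounded]
      simp_rw [norm_cexp_neg_mul]
      refine Real.tendsto_exp_atTop.comp ?_
      simpa using tendsto_id.const_mul_atBot_of_neg (neg_neg_of_pos hα0)
    simpa [hankelResolvent] using h.mul (tendsto_cexp_mul_cexp_atBot t θ)

lemma hasSum_hankelPow {α : ℝ} (t : ℝ) (hα0 : 0 < α) {w : ℂ} (hw : 0 < w.re) :
    HasSum (fun j : ℕ => (-1) ^ j * hankelPow (j * α) t w) (hankelResolvent α t w) := by
  have hn : ‖-cexp (-(α * w))‖ < 1 := by
    rw [norm_neg, norm_cexp_neg_mul]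
    exact Real.exp_lt_one_iff.2 (by nlinarith)
  have h := (hasSum_geometric_of_norm_lt_one hn).mul_right (cexp (t * cexp w))
  rw [sub_neg_eq_add] at h
  refine h.congr_fun fun j => ?_
  rw [hankelPow, neg_pow (cexp _), ← Complex.exp_nat_mul, ← mul_assoc]
  push_cast
  ring_nf

lemma exp_neg_nat_mul_le {α u : ℝ} (hα0 : 0 < α) (hu : 1 ≤ u) (j : ℕ) :
    Real.exp (-(j * α * u)) ≤ Real.exp (-α) ^ j := by
  rw [← Real.exp_nat_mul, Real.exp_le_exp]
  have : (j : ℝ) * α * 1 ≤ j * α * u := by gcongr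
  linarith

lemma hasSum_integral_stripJump {α t : ℝ} (hα0 : 0 < α) (ht : 0 < t) :
    HasSum (fun j : ℕ => ∫ u in Ioi 1, (-1) ^ j * stripJump (hankelPow (j * α) t) u)
      (∫ u in Ioi 1, stripJump (hankelResolvent α t) u) := by
  have hpt : ∀ u ∈ Ioi (1 : ℝ), ∑' j : ℕ, (-1) ^ j * stripJump (hankelPow (j * α) t) u =
      stripJump (hankelResolvent α t) u := by
    intro u hu
    have hu' : (0 : ℝ) < u := one_pos.trans hu
    have hp := hasSum_hankelPow t hα0 (w := u + π * I) (by simpa using hu')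
    have hm := hasSum_hankelPow t hα0 (w := u - π * I) (by simpa using hu')
    rw [stripJump, ← (hp.sub hm).tsum_eq]
    simp only [stripJump, mul_sub]
  rw [← setIntegral_congr_fun measurableSet_Ioi hpt]
  refine hasSum_integral_of_summable_integral_norm
    (fun j => (integrableOn_stripJump_hankelPow _ 1 ht).const_mul _) ?_
  have hr : Real.exp (-α) < 1 := Real.exp_lt_one_iff.2 (by linarith)
  have h0 : IntegrableOn (fun u : ℝ => Real.exp (-(t * Real.exp u))) (Ioi 1) := by
    simpa using integrableOn_exp_mul_exp_neg_exp 0 1 ht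
  refine Summable.of_nonneg_of_le (fun j => integral_nonneg fun u => norm_nonneg _) (fun j => ?_)
    ((summable_geometric_of_lt_one (Real.exp_pos _).le hr).mul_right
      (2 * ∫ u in Ioi 1, Real.exp (-(t * Real.exp u))))
  rw [← integral_const_mul, ← integral_const_mul]
  refine setIntegral_mono_on ((integrableOn_stripJump_hankelPow _ 1 ht).const_mul _).norm
    ((h0.const_mul _).const_mul _) measurableSet_Ioi fun u hu => ?_
  rw [stripJump_hankelPow, norm_mul, norm_mul, norm_real, norm_neg, norm_mul, norm_mul, norm_real,
    norm_pow, norm_neg, norm_one, one_pow, one_mul, norm_I, mul_one, Real.norm_of_nonneg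
    (mul_nonneg (Real.exp_pos _).le (Real.exp_pos _).le), Complex.norm_two]
  calc 2 * ‖Real.sin (j * α * π)‖ *
        (Real.exp (-(j * α * u)) * Real.exp (-(t * Real.exp u)))
      ≤ 2 * 1 * (Real.exp (-α) ^ j * Real.exp (-(t * Real.exp u))) := by
        gcongr
        · exact Real.abs_sin_le_one _
        · exact exp_neg_nat_mul_le hα0 (le_of_lt hu) j
    _ = _ := by ring

lemma hasSum_integral_vertical {α t : ℝ} (hα0 : 0 < α) (ht : 0 < t) :
    HasSum (fun j : ℕ => ∫ θ in (-π)..π, (-1) ^ j * hankelPow (j * α) t ((1 : ℝ) + θ * I))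
      (∫ θ in (-π)..π, hankelResolvent α t ((1 : ℝ) + θ * I)) := by
  have hr : Real.exp (-α) < 1 := Real.exp_lt_one_iff.2 (by linarith)
  refine intervalIntegral.hasSum_integral_of_dominated_convergence
    (fun j _ => Real.exp (-α) ^ j * Real.exp (t * Real.exp 1)) (fun j => ?_)
    (fun j => Eventually.of_forall fun θ _ => ?_)
    (Eventually.of_forall fun θ _ => (summable_geometric_of_lt_one (Real.exp_pos _).le hr).mul_right
      _) intervalIntegrable_const
    (Eventually.of_forall fun θ _ => hasSum_hankelPow t hα0 (by simp))
  · have := (differentiable_hankelPow (j * α) t).continuous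
    exact Continuous.aestronglyMeasurable (by fun_prop)
  · rw [norm_mul, norm_pow, norm_neg, norm_one, one_pow, one_mul, hankelPow, norm_mul,
      norm_cexp_neg_mul]
    have h1 := norm_cexp_mul_cexp_le ht ((1 : ℝ) + θ * I)
    have h2 := exp_neg_nat_mul_le hα0 le_rfl j
    have hre : (((1 : ℝ) : ℂ) + θ * I).re = 1 := by simp
    rw [hre] at h1 ⊢
    gcongr

lemma hasSum_hankelIntegral {α t : ℝ} (hα0 : 0 < α) (ht : 0 < t) :
    HasSum (fun j : ℕ => (-1) ^ j * hankelIntegral (hankelPow (j * α) t) 1)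
      (hankelIntegral (hankelResolvent α t) 1) := by
  refine ((hasSum_integral_stripJump hα0 ht).add
    ((hasSum_integral_vertical hα0 ht).mul_left I)).congr_fun fun j => ?_
  rw [integral_const_mul, intervalIntegral.integral_const_mul, hankelIntegral]
  ring

lemma mittagLeffler_eq_integral_fKer {α t : ℝ} (hα0 : 0 < α) (hα1 : α < 1) (ht : 0 < t) :
    mittagLeffler α (-(t ^ α)) = ∫ x in Ioi 0, fKer x t α := by
  have h := hasSum_hankelIntegral hα0 ht
  rw [hankelIntegral_hankelResolvent hα0 hα1 ht] at h
  simp_rw [hankelIntegral_hankelPow _ _ ht] at h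
  have hc : (2 * π * I : ℂ) ≠ 0 := two_pi_I_ne_zero
  have h2 := h.mul_left (2 * π * I : ℂ)⁻¹
  rw [inv_mul_cancel_left₀ hc] at h2
  refine HasSum.tsum_eq (hasSum_ofReal.1 (h2.congr_fun fun j => ?_))
  rw [neg_pow, ← Real.rpow_natCast (t ^ α), ← Real.rpow_mul ht.le, mul_comm α]
  push_cast
  field_simp

lemma integral_fKer_Ioi_le {α t Q : ℝ} (hα0 : 0 < α) (hα1 : α < 1) (ht : 0 < t) (hQ : 1 < Q) :
    ∫ x in Ioi Q, fKer x t α ≤ 1 / (Q - 1) := by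
  have hder : ∀ x ∈ Ici Q, HasDerivAt (fun x : ℝ => -(x - 1)⁻¹) (1 / (x - 1) ^ 2) x := by
    intro x hx
    have hx1 : x - 1 ≠ 0 := (sub_pos.2 (hQ.trans_le hx)).ne'
    refine (((hasDerivAt_id x).sub_const 1).inv hx1).neg.congr_deriv ?_
    simp only [id]
    ring
  have hpos : ∀ x ∈ Ioi Q, (0 : ℝ) ≤ 1 / (x - 1) ^ 2 := fun x _ => by positivity
  have hlim : Tendsto (fun x : ℝ => -(x - 1)⁻¹) atTop (𝓝 0) := by
    simpa [← sub_eq_add_neg] using (tendsto_inv_atTop_zero.comp (tendsto_atTop_add_const_right atTop (-1 : ℝ)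
      tendsto_id)).neg
  have hval := integral_Ioi_of_hasDerivAt_of_nonneg' hder hpos hlim
  have hint := integrableOn_Ioi_deriv_of_nonneg' hder hpos hlim
  calc ∫ x in Ioi Q, fKer x t α ≤ ∫ x in Ioi Q, 1 / (x - 1) ^ 2 := by
        refine setIntegral_mono_on ((integrableOn_fKer hα0 hα1 ht).mono_set
          (Ioi_subset_Ioi (by linarith))) hint measurableSet_Ioi fun x hx => ?_
        have hx1 : 1 < x := hQ.trans hx
        refine (fKer_le hα0 hα1 ht (by linarith)).trans (one_div_le_one_div_of_le ?_ ?_)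
        · have := sub_pos.2 hx1
          positivity
        · nlinarith [Real.neg_one_le_cos (α * π)]
    _ = 1 / (Q - 1) := by rw [hval]; simp

lemma sum_integral_fKer {α q t : ℝ} (hα0 : 0 < α) (hα1 : α < 1) (hq : 1 < q) (ht : 0 < t) (K : ℕ) :
    ∑ k ∈ Finset.range (K + 1), ∫ x in (cCtr q k - rRad q k)..(cCtr q k + rRad q k), fKer x t α =
      ∫ x in 0..q ^ K, fKer x t α := by
  let a : ℕ → ℝ := fun k => if k = 0 then 0 else q ^ (k - 1)
  have ha : ∀ k, 0 ≤ a k := fun k => by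
    simp only [a]; split_ifs <;> positivity
  have hlo : ∀ k, cCtr q k - rRad q k = a k := by
    rintro (_ | k) <;> simp only [cCtr, rRad, a] <;> simp
    ring
  have hhi : ∀ k, cCtr q k + rRad q k = a (k + 1) := by
    rintro (_ | k) <;> simp only [cCtr, rRad, a] <;> norm_num
    ring
  simp_rw [hlo, hhi]
  rw [intervalIntegral.sum_integral_adjacent_intervals]
  · simp [a]
  · intro k _
    exact intervalIntegrable_iff.2 ((integrableOn_fKer hα0 hα1 ht).mono_set
      fun x hx => (le_min (ha _) (ha _)).trans_lt hx.1)

theorem truncation_error_bound (α q t : ℝ) (hα0 : 0 < α) (hα1 : α < 1) (hq : 1 < q)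
    (ht : 0 < t) (K : ℕ) (hK : 1 ≤ K) :
    (0 ≤ mittagLeffler α (-(t ^ α)) -
        ∑ k ∈ Finset.range (K + 1),
          ∫ x in (cCtr q k - rRad q k)..(cCtr q k + rRad q k), fKer x t α) ∧
    mittagLeffler α (-(t ^ α)) -
        (∑ k ∈ Finset.range (K + 1),
          ∫ x in (cCtr q k - rRad q k)..(cCtr q k + rRad q k), fKer x t α) ≤
      1 / (q ^ K - 1) := by
  have hQ : 1 < q ^ K := one_lt_pow₀ hq (by omega)
  have hI := integrableOn_fKer hα0 hα1 ht
  rw [sum_integral_fKer hα0 hα1 hq ht, mittagLeffler_eq_integral_fKer hα0 hα1 ht,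
    ← intervalIntegral.integral_interval_add_Ioi hI
      (hI.mono_set (Ioi_subset_Ioi (zero_le_one.trans hQ.le))), add_sub_cancel_left]
  exact ⟨integral_nonneg fun x => fKer_nonneg hα0 hα1 x t, integral_fKer_Ioi_le hα0 hα1 ht hQ⟩
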